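/- Let A, Φ ∈ ℂ^{m×d}, let s ≥ 1, and suppose A satisfies the restricted isometry property with parameters (s, δ) for some 0 ≤ δ < 1. Let x ∈ ℂ^d with x_s ≠ 0, and set α_s = ‖x − x_s‖₂/‖x_s‖₂, β_s = ‖x − x_s‖₁/(√s ‖x_s‖₂), and κ_A^{(s)} = √(1+δ)/√(1−δ). If α_s + β_s ≤ 1/(2 κ_A^{(s)}), then ‖(A − Φ)x‖₂ ≤ (2/√(1 − δ)) ( ‖A − Φ‖₂ α_s + ‖A − Φ‖^{(s)} ) ‖Ax‖₂. -/

import Mathlib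

open scoped BigOperators

/-- The Euclidean (ℓ²) norm of a vector. -/
noncomputable def l2 {n : ℕ} (x : Fin n → ℂ) : ℝ := Real.sqrt (∑ i, ‖x i‖ ^ 2)

/-- The ℓ¹ norm of a vector. -/
noncomputable def l1 {n : ℕ} (x : Fin n → ℂ) : ℝ := ∑ i, ‖x i‖

/-- `x` has at most `s` nonzero entries. -/
def Sparse {n : ℕ} (s : ℕ) (x : Fin n → ℂ) : Prop :=
  ∃ T : Finset (Fin n), T.card ≤ s ∧ ∀ i ∉ T, x i = 0

/-- `A` satisfies the restricted isometry property with parameters `(s, δ)`. -/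
def RIP {m d : ℕ} (A : Matrix (Fin m) (Fin d) ℂ) (s : ℕ) (δ : ℝ) : Prop :=
  ∀ x : Fin d → ℂ, Sparse s x →
    (1 - δ) * (l2 x) ^ 2 ≤ (l2 (A.mulVec x)) ^ 2 ∧
      (l2 (A.mulVec x)) ^ 2 ≤ (1 + δ) * (l2 x) ^ 2

/-- The spectral norm `‖M‖₂` of a matrix. -/
noncomputable def specNorm {m d : ℕ} (M : Matrix (Fin m) (Fin d) ℂ) : ℝ :=
  sSup {r | ∃ x : Fin d → ℂ, l2 x ≤ 1 ∧ r = l2 (M.mulVec x)}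

/-- `‖M‖^{(s)}`: the largest spectral norm over all `s`-column submatrices of `M`,
equivalently the sup of `‖Mx‖₂` over `s`-sparse `x` with `‖x‖₂ ≤ 1`. -/
noncomputable def specNormS {m d : ℕ} (s : ℕ) (M : Matrix (Fin m) (Fin d) ℂ) : ℝ :=
  sSup {r | ∃ x : Fin d → ℂ, Sparse s x ∧ l2 x ≤ 1 ∧ r = l2 (M.mulVec x)}

/-- `xs` is a best `s`-sparse approximation of `x`: it keeps `s` entries of `x` of
largest magnitude (all entries if `x` has fewer than `s` coordinates) and sets the
others to zero. -/
def IsSparseApprox {n : ℕ} (s : ℕ) (x xs : Fin n → ℂ) : Prop :=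
  ∃ T : Finset (Fin n), T.card = min s n ∧
    (∀ i, xs i = if i ∈ T then x i else 0) ∧
    ∀ i ∈ T, ∀ j ∉ T, ‖x j‖ ≤ ‖x i‖

lemma l2_eq_norm {n : ℕ} (x : Fin n → ℂ) : l2 x = ‖WithLp.toLp 2 x‖ := by
  simp [l2, EuclideanSpace.norm_eq]

lemma l2_nonneg {n : ℕ} (x : Fin n → ℂ) : 0 ≤ l2 x := Real.sqrt_nonneg _

lemma l2_add_le {n : ℕ} (x y : Fin n → ℂ) : l2 (x + y) ≤ l2 x + l2 y := by
  simpa [l2_eq_norm] using norm_add_le (WithLp.toLp 2 x) (WithLp.toLp 2 y)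

lemma l2_smul {n : ℕ} (c : ℂ) (x : Fin n → ℂ) : l2 (c • x) = ‖c‖ * l2 x := by
  simpa [l2_eq_norm] using norm_smul c (WithLp.toLp 2 x)

lemma l2_pos {n : ℕ} {x : Fin n → ℂ} (hx : x ≠ 0) : 0 < l2 x := by
  simpa [l2_eq_norm] using hx

lemma exists_l2_mulVec_le {m d : ℕ} (M : Matrix (Fin m) (Fin d) ℂ) :
    ∃ C, 0 ≤ C ∧ ∀ x, l2 (M.mulVec x) ≤ C * l2 x := by
  let L := LinearMap.toContinuousLinearMap (Matrix.toEuclideanLin M)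
  refine ⟨‖L‖, norm_nonneg _, fun x => ?_⟩
  rw [l2_eq_norm, l2_eq_norm]
  exact L.le_opNorm (WithLp.toLp 2 x)

/-- A supremum of `‖Mx‖₂` over the unit vectors of a homogeneous set bounds `M` on that set. -/
lemma l2_mulVec_le_sSup_mul {m d : ℕ} (M : Matrix (Fin m) (Fin d) ℂ)
    (P : (Fin d → ℂ) → Prop) (hP : ∀ (c : ℂ) x, P x → P (c • x))
    {x : Fin d → ℂ} (hx : P x) :
    l2 (M.mulVec x) ≤ sSup {r | ∃ x, P x ∧ l2 x ≤ 1 ∧ r = l2 (M.mulVec x)} * l2 x := by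
  obtain ⟨C, hC, hM⟩ := exists_l2_mulVec_le M
  have hbdd : BddAbove {r | ∃ x, P x ∧ l2 x ≤ 1 ∧ r = l2 (M.mulVec x)} := by
    refine ⟨C, ?_⟩
    rintro _ ⟨y, -, hy, rfl⟩
    exact (hM y).trans (mul_le_of_le_one_right hC hy)
  rcases (l2_nonneg x).eq_or_lt with h0 | hpos
  · simpa [← h0] using hM x
  · have hn : ‖((l2 x : ℂ))⁻¹‖ = (l2 x)⁻¹ := by
      rw [norm_inv, Complex.norm_real, Real.norm_of_nonneg hpos.le]
    have key := le_csSup hbdd ⟨((l2 x : ℂ))⁻¹ • x, hP _ _ hx, by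
      rw [l2_smul, hn, inv_mul_cancel₀ hpos.ne'], rfl⟩
    rw [Matrix.mulVec_smul, l2_smul, hn] at key
    rwa [inv_mul_eq_div, div_le_iff₀ hpos] at key

lemma Sparse.smul {n s : ℕ} {x : Fin n → ℂ} (hx : Sparse s x) (c : ℂ) : Sparse s (c • x) := by
  obtain ⟨T, hT, h⟩ := hx
  exact ⟨T, hT, fun i hi => by simp [h i hi]⟩

lemma l2_mulVec_le_specNorm_mul {m d : ℕ} (M : Matrix (Fin m) (Fin d) ℂ) (x : Fin d → ℂ) :
    l2 (M.mulVec x) ≤ specNorm M * l2 x := by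
  simpa [specNorm] using
    l2_mulVec_le_sSup_mul M (fun _ => True) (fun _ _ _ => trivial) (x := x) trivial

lemma l2_mulVec_le_specNormS_mul {m d s : ℕ} (M : Matrix (Fin m) (Fin d) ℂ) {x : Fin d → ℂ}
    (hx : Sparse s x) : l2 (M.mulVec x) ≤ specNormS s M * l2 x :=
  l2_mulVec_le_sSup_mul M (Sparse s) (fun c _ h => h.smul c) hx

lemma specNorm_nonneg {m d : ℕ} (M : Matrix (Fin m) (Fin d) ℂ) : 0 ≤ specNorm M :=
  Real.sSup_nonneg (by rintro _ ⟨x, -, rfl⟩; exact l2_nonneg _)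

lemma specNormS_nonneg {m d : ℕ} (s : ℕ) (M : Matrix (Fin m) (Fin d) ℂ) : 0 ≤ specNormS s M :=
  Real.sSup_nonneg (by rintro _ ⟨x, -, -, rfl⟩; exact l2_nonneg _)

lemma RIP.le_l2_mulVec {m d s : ℕ} {A : Matrix (Fin m) (Fin d) ℂ} {δ : ℝ} (h : RIP A s δ)
    {x : Fin d → ℂ} (hx : Sparse s x) : √(1 - δ) * l2 x ≤ l2 (A.mulVec x) := by
  have := Real.sqrt_le_sqrt (h x hx).1
  rwa [Real.sqrt_mul' _ (sq_nonneg _), Real.sqrt_sq (l2_nonneg _),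
    Real.sqrt_sq (l2_nonneg _)] at this

lemma RIP.l2_mulVec_le {m d s : ℕ} {A : Matrix (Fin m) (Fin d) ℂ} {δ : ℝ} (h : RIP A s δ)
    {x : Fin d → ℂ} (hx : Sparse s x) : l2 (A.mulVec x) ≤ √(1 + δ) * l2 x := by
  have := Real.sqrt_le_sqrt (h x hx).2
  rwa [Real.sqrt_mul' _ (sq_nonneg _), Real.sqrt_sq (l2_nonneg _),
    Real.sqrt_sq (l2_nonneg _)] at this

/-- Any finite set contains a subset of prescribed size on which `f` is largest. -/
lemma exists_subset_card_eq_largest {ι : Type*} [DecidableEq ι] (f : ι → ℝ) (U : Finset ι)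
    (k : ℕ) (hk : k ≤ U.card) :
    ∃ T ⊆ U, T.card = k ∧ ∀ i ∈ T, ∀ j ∈ U \ T, f j ≤ f i := by
  induction k with
  | zero => exact ⟨∅, by simp⟩
  | succ k ih =>
    obtain ⟨T, hTU, hT, h⟩ := ih (by omega)
    have hne : (U \ T).Nonempty := by
      rw [← Finset.card_pos, Finset.card_sdiff_of_subset hTU]
      omega
    obtain ⟨a, ha, hmax⟩ := Finset.exists_max_image (U \ T) f hne
    have haUT := Finset.mem_sdiff.1 ha
    refine ⟨insert a T, Finset.insert_subset haUT.1 hTU, by simp [haUT.2, hT], ?_⟩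
    intro i hi j hj
    have hj' : j ∈ U \ T := by grind
    rcases Finset.mem_insert.1 hi with rfl | hi
    · exact hmax j hj'
    · exact h i hi j hj'

lemma ite_add_ite_not_mem {d : ℕ} (T : Finset (Fin d)) (v : Fin d → ℂ) :
    v = (fun i => if i ∈ T then v i else 0) + fun i => if i ∈ T then 0 else v i := by
  ext i
  by_cases hi : i ∈ T <;> simp [hi]

lemma l1_ite_not_mem {d : ℕ} (T : Finset (Fin d)) (v : Fin d → ℂ) :
    l1 v = ∑ i ∈ T, ‖v i‖ + l1 fun i => if i ∈ T then 0 else v i := by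
  simp only [l1]
  rw [← Finset.sum_add_sum_compl T, ← Finset.sum_add_sum_compl T (fun i => ‖ite _ _ _‖)]
  have h1 : ∑ i ∈ T, ‖if i ∈ T then 0 else v i‖ = 0 :=
    Finset.sum_eq_zero fun i hi => by simp [hi]
  have h2 : ∑ i ∈ Tᶜ, ‖if i ∈ T then 0 else v i‖ = ∑ i ∈ Tᶜ, ‖v i‖ :=
    Finset.sum_congr rfl fun i hi => by simp [Finset.mem_compl.1 hi]
  rw [h1, h2, zero_add]

lemma l2_ite_mem_le {d : ℕ} (T : Finset (Fin d)) (v : Fin d → ℂ) :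
    l2 (fun i => if i ∈ T then v i else 0) ≤ l2 v := by
  refine Real.sqrt_le_sqrt (Finset.sum_le_sum fun i _ => ?_)
  by_cases hi : i ∈ T <;> simp [hi]

lemma l2_le_sqrt_mul_of_sparse {d s : ℕ} {v : Fin d → ℂ} (hv : Sparse s v) {c : ℝ} (hc : 0 ≤ c)
    (hvc : ∀ i, ‖v i‖ ≤ c) : l2 v ≤ √s * c := by
  obtain ⟨T, hT, h⟩ := hv
  refine Real.sqrt_le_iff.2 ⟨by positivity, ?_⟩
  rw [mul_pow, Real.sq_sqrt (Nat.cast_nonneg s)]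
  calc ∑ i, ‖v i‖ ^ 2 = ∑ i ∈ T, ‖v i‖ ^ 2 :=
        (Finset.sum_subset (Finset.subset_univ T) fun i _ hi => by simp [h i hi]).symm
    _ ≤ ∑ _i ∈ T, c ^ 2 := Finset.sum_le_sum fun i _ =>
        pow_le_pow_left₀ (norm_nonneg _) (hvc i) 2
    _ = T.card * c ^ 2 := by simp
    _ ≤ s * c ^ 2 := by gcongr

/-- If every entry of `v` off `T` is dominated by those on `T`, the entries off `T` are bounded by
some `c` with `√|T| c ≤ (∑_T |v|) / √|T|`. -/
lemma exists_bound_off {d s : ℕ} (hs : 1 ≤ s) {T : Finset (Fin d)} (hT : T.card = s)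
    {v : Fin d → ℂ} (h : ∀ i ∈ T, ∀ j ∉ T, ‖v j‖ ≤ ‖v i‖) :
    ∃ c, 0 ≤ c ∧ (∀ i, ‖if i ∈ T then 0 else v i‖ ≤ c) ∧ √s * c ≤ (∑ i ∈ T, ‖v i‖) / √s := by
  have hs0 : (0 : ℝ) < s := by exact_mod_cast hs
  obtain ⟨a, ha, hmin⟩ := Finset.exists_min_image T (fun i => ‖v i‖)
    (Finset.card_pos.1 (by omega))
  refine ⟨‖v a‖, norm_nonneg _, fun i => ?_, ?_⟩
  · by_cases hi : i ∈ T
    · simp [hi]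
    · simpa [hi] using h a ha i hi
  · rw [le_div_iff₀ (Real.sqrt_pos.2 hs0), mul_right_comm, Real.mul_self_sqrt hs0.le]
    simpa [hT] using Finset.card_nsmul_le_sum T (fun i => ‖v i‖) ‖v a‖ hmin

lemma RIP.l2_mulVec_le_of_bound {m d s : ℕ} (hs : 1 ≤ s) {A : Matrix (Fin m) (Fin d) ℂ} {δ : ℝ}
    (h : RIP A s δ) (U : Finset (Fin d)) (v : Fin d → ℂ) (hU : ∀ i ∉ U, v i = 0) {c : ℝ}
    (hc : 0 ≤ c) (hvc : ∀ i, ‖v i‖ ≤ c) :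
    l2 (A.mulVec v) ≤ √(1 + δ) * (√s * c + l1 v / √s) := by
  induction U using Finset.strongInduction generalizing v c with
  | H U ih =>
  by_cases hUs : U.card ≤ s
  · have hv : Sparse s v := ⟨U, hUs, hU⟩
    have h1 : 0 ≤ l1 v / √s := div_nonneg (Finset.sum_nonneg fun _ _ => norm_nonneg _) (by simp)
    refine (h.l2_mulVec_le hv).trans ?_
    gcongr
    linarith [l2_le_sqrt_mul_of_sparse hv hc hvc]
  · obtain ⟨T, hTU, hT, hmax⟩ :=
      exists_subset_card_eq_largest (fun i => ‖v i‖) U s (by omega)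
    have hdom : ∀ i ∈ T, ∀ j ∉ T, ‖v j‖ ≤ ‖v i‖ := by
      intro i hi j hj
      by_cases hjU : j ∈ U
      · exact hmax i hi j (Finset.mem_sdiff.2 ⟨hjU, hj⟩)
      · simp [hU j hjU]
    obtain ⟨c', hc', hvc', hsum⟩ := exists_bound_off hs hT hdom
    have hne : T.Nonempty := Finset.card_pos.1 (by omega)
    have hrest := ih (U \ T) (Finset.sdiff_ssubset hTU hne) (fun i => if i ∈ T then 0 else v i)
      (fun i hi => by
        by_cases hiT : i ∈ T
        · simp [hiT]
        · simpa [hiT] using hU i (by grind)) hc' hvc'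
    have hsp : Sparse s fun i => if i ∈ T then v i else 0 :=
      ⟨T, hT.le, fun i hi => by simp [hi]⟩
    have hhead := (h.l2_mulVec_le hsp).trans (mul_le_mul_of_nonneg_left
      (l2_le_sqrt_mul_of_sparse hsp hc fun i => by
        by_cases hi : i ∈ T
        · simpa [hi] using hvc i
        · simpa [hi] using hc) (Real.sqrt_nonneg (1 + δ)))
    have htri := l2_add_le (A.mulVec fun i => if i ∈ T then v i else 0)
      (A.mulVec fun i => if i ∈ T then 0 else v i)
    rw [← Matrix.mulVec_add, ← ite_add_ite_not_mem] at htri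
    rw [l1_ite_not_mem T v, add_div]
    have := mul_le_mul_of_nonneg_left hsum (Real.sqrt_nonneg (1 + δ))
    linarith

/-- The energy bound for matrices with the upper restricted isometry inequality. -/
lemma RIP.l2_mulVec_le_l2_add_l1 {m d s : ℕ} (hs : 1 ≤ s) {A : Matrix (Fin m) (Fin d) ℂ} {δ : ℝ}
    (h : RIP A s δ) (v : Fin d → ℂ) :
    l2 (A.mulVec v) ≤ √(1 + δ) * (l2 v + l1 v / √s) := by
  by_cases hds : d ≤ s
  · have h1 : 0 ≤ l1 v / √s := div_nonneg (Finset.sum_nonneg fun _ _ => norm_nonneg _) (by simp)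
    refine (h.l2_mulVec_le ⟨Finset.univ, by simpa using hds, by simp⟩).trans ?_
    gcongr
    linarith
  · obtain ⟨T, -, hT, hmax⟩ :=
      exists_subset_card_eq_largest (fun i => ‖v i‖) Finset.univ s (by simp; omega)
    obtain ⟨c, hc, hvc, hsum⟩ := exists_bound_off hs hT
      (fun i hi j hj => hmax i hi j (by simpa using hj))
    have hrest := h.l2_mulVec_le_of_bound hs Finset.univ _ (by simp) hc hvc
    have hhead := (h.l2_mulVec_le (x := fun i => if i ∈ T then v i else 0)
      ⟨T, hT.le, fun i hi => by simp [hi]⟩).trans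
      (mul_le_mul_of_nonneg_left (l2_ite_mem_le T v) (Real.sqrt_nonneg (1 + δ)))
    have htri := l2_add_le (A.mulVec fun i => if i ∈ T then v i else 0)
      (A.mulVec fun i => if i ∈ T then 0 else v i)
    rw [← Matrix.mulVec_add, ← ite_add_ite_not_mem] at htri
    rw [l1_ite_not_mem T v, add_div]
    have := mul_le_mul_of_nonneg_left hsum (Real.sqrt_nonneg (1 + δ))
    linarith

lemma IsSparseApprox.sparse {n s : ℕ} {x xs : Fin n → ℂ} (h : IsSparseApprox s x xs) :
    Sparse s xs := by
  obtain ⟨T, hT, hx, -⟩ := h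
  exact ⟨T, by omega, fun i hi => by simp [hx, hi]⟩

/-- Multiplicative noise bound under the compressibility condition
`α_s + β_s ≤ 1 / (2 κ_A^{(s)})`. -/
theorem mult_noise_compressible (m d s : ℕ) (hs : 1 ≤ s)
    (A Φ : Matrix (Fin m) (Fin d) ℂ)
    (δ : ℝ) (hδ0 : 0 ≤ δ) (hδ1 : δ < 1) (hRIP : RIP A s δ)
    (x xs : Fin d → ℂ) (hxs : IsSparseApprox s x xs) (hxs0 : xs ≠ 0)
    -- `α_s + β_s ≤ 1 / (2 κ_A^{(s)})`
    (hcond : l2 (x - xs) / l2 xs + l1 (x - xs) / (Real.sqrt s * l2 xs)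
        ≤ 1 / (2 * (Real.sqrt (1 + δ) / Real.sqrt (1 - δ)))) :
    l2 ((A - Φ).mulVec x)
      ≤ 2 / Real.sqrt (1 - δ)
          * (specNorm (A - Φ) * (l2 (x - xs) / l2 xs) + specNormS s (A - Φ))
          * l2 (A.mulVec x) := by
  have hN := l2_pos hxs0
  have ha : 0 < √(1 - δ) := Real.sqrt_pos.2 (by linarith)
  have hb : 0 < √(1 + δ) := Real.sqrt_pos.2 (by linarith)
  have hsparse := hxs.sparse
  have htail : l2 (A.mulVec (x - xs)) ≤ √(1 - δ) * l2 xs / 2 := by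
    refine (hRIP.l2_mulVec_le_l2_add_l1 hs (x - xs)).trans ?_
    calc √(1 + δ) * (l2 (x - xs) + l1 (x - xs) / √s)
        = √(1 + δ) * l2 xs * (l2 (x - xs) / l2 xs + l1 (x - xs) / (√s * l2 xs)) := by
          rw [← div_div]
          field_simp
      _ ≤ √(1 + δ) * l2 xs * (1 / (2 * (√(1 + δ) / √(1 - δ)))) := by gcongr
      _ = √(1 - δ) * l2 xs / 2 := by field_simp
  have hlow : √(1 - δ) * l2 xs / 2 ≤ l2 (A.mulVec x) := by
    have htri := l2_add_le (A.mulVec x) ((-1 : ℂ) • A.mulVec (x - xs))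
    rw [l2_smul, ← Matrix.mulVec_smul, ← Matrix.mulVec_add] at htri
    have hx : x + (-1 : ℂ) • (x - xs) = xs := by simp
    rw [hx, norm_neg, norm_one, one_mul] at htri
    linarith [hRIP.le_l2_mulVec hsparse]
  have hup : l2 ((A - Φ).mulVec x) ≤
      specNorm (A - Φ) * l2 (x - xs) + specNormS s (A - Φ) * l2 xs := by
    have htri := l2_add_le ((A - Φ).mulVec (x - xs)) ((A - Φ).mulVec xs)
    rw [← Matrix.mulVec_add, sub_add_cancel] at htri
    linarith [l2_mulVec_le_specNorm_mul (A - Φ) (x - xs),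
      l2_mulVec_le_specNormS_mul (A - Φ) hsparse]
  have hK : 0 ≤ specNorm (A - Φ) * (l2 (x - xs) / l2 xs) + specNormS s (A - Φ) :=
    add_nonneg (mul_nonneg (specNorm_nonneg _) (div_nonneg (l2_nonneg _) hN.le))
      (specNormS_nonneg _ _)
  calc l2 ((A - Φ).mulVec x)
      ≤ specNorm (A - Φ) * l2 (x - xs) + specNormS s (A - Φ) * l2 xs := hup
    _ = 2 / √(1 - δ) * (specNorm (A - Φ) * (l2 (x - xs) / l2 xs) + specNormS s (A - Φ))
          * (√(1 - δ) * l2 xs / 2) := by field_simp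
    _ ≤ _ := by gcongr
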